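/- arXiv:2003.11123 — 3 statements merged into one kernel-verified Lean document; each statement's English description precedes it below -/
import Mathlib

section
/- Let A, A' be unital C*-algebras, P₁ a nontrivial projection in A, P₂ = I - P₁, and suppose A' satisfies: X A' φ(P_i) = {0} implies X = 0 (for i = 1, 2). Then a bijective unital map φ: A → A' is a multiplicative *-Lie-Jordan n-map if and only if φ is a *-ring isomorphism (additive, multiplicative, and φ(A*) = φ(A)* for all A). -/
def lieStar {R : Type*} [NonUnitalRing R] [StarRing R] (x y : R) : R := x * y - y * star x
def jordanStar {R : Type*} [NonUnitalRing R] [StarRing R] (x y : R) : R := x * y + y * star x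
def pStar {R : Type*} [NonUnitalRing R] [StarRing R] (x : R) (l : List R) : R := l.foldl lieStar x
def qStar {R : Type*} [NonUnitalRing R] [StarRing R] (x : R) (l : List R) : R := l.foldl jordanStar x

section Peirce

variable {R : Type*} [Ring R] {p x y z a b c : R}

lemma mul_mul_of_mul_eq (hxy : x * y = a) (z : R) : x * (y * z) = a * z := by
  rw [← mul_assoc, hxy]

/-- The Peirce decomposition of `x` with respect to `p`. -/
lemma peirce_decomposition (p x : R) :
    x = p * x * p + p * x * (1 - p) + ((1 - p) * x * p + (1 - p) * x * (1 - p)) := by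
  noncomm_ring

lemma IsIdempotentElem.mul_mul_self_eq_zero_of_off (hp : IsIdempotentElem p)
    (hy : y = p * y + y * p) : p * y * p = 0 := by
  have h1 : p * y * p = p * y * p + p * y * p := by
    conv_lhs => rw [hy]
    simp only [mul_add, add_mul, mul_assoc, hp.eq]
    simp only [← mul_assoc, hp.eq]
  simpa using h1

lemma IsIdempotentElem.off_corner (hp : IsIdempotentElem p) (x : R) :
    p * (p * x * (1 - p)) = p * x * (1 - p) ∧ p * x * (1 - p) * p = 0 := by
  constructor
  · simp only [← mul_assoc, hp.eq]
  · rw [mul_assoc, hp.one_sub_mul_self, mul_zero]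

lemma IsIdempotentElem.off_part (hp : IsIdempotentElem p) (x : R) :
    (1 - p) * (p * x + x * p) + (p * x + x * p) * (1 - p) =
      p * x * (1 - p) + (1 - p) * x * p := by
  have h := hp.eq
  simp only [mul_add, add_mul, mul_sub, sub_mul, one_mul, mul_one, mul_assoc, h,
    mul_mul_of_mul_eq h]
  abel

lemma IsIdempotentElem.off_part_eq (hp : IsIdempotentElem p) (x : R) :
    p * x * (1 - p) + (1 - p) * x * p =
      p * (p * x * (1 - p) + (1 - p) * x * p) + (p * x * (1 - p) + (1 - p) * x * p) * p := by
  have h := hp.eq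
  simp only [mul_add, add_mul, mul_sub, sub_mul, one_mul, mul_one, mul_assoc, h,
    mul_mul_of_mul_eq h]
  abel

lemma IsIdempotentElem.off_part_mul (hp : IsIdempotentElem p) (x : R) :
    (p * x * (1 - p) + (1 - p) * x * p) * (1 - p) = p * x * (1 - p) := by
  have h := hp.eq
  simp only [add_mul, mul_sub, sub_mul, one_mul, mul_one, mul_assoc, h]
  abel

variable [StarRing R]

lemma anticommute_jordan_off (hp : p * p = p) (hs : star p = p)
    (hy : y = p * y + y * p) (hc : p * c = c) (hcp : c * p = 0) :
    p * (y * c + c * star y) + (y * c + c * star y) * p = c * star y + c * star y := by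
  have e1 : p * (y * c) = 0 := by
    rw [← hc, ← mul_assoc y, ← mul_assoc, ← mul_assoc,
      IsIdempotentElem.mul_mul_self_eq_zero_of_off hp hy, zero_mul]
  have e2 : c * star y * p = c * star y := by
    have : star y = star y * p + p * star y := by
      conv_lhs => rw [hy]
      simp [hs]
    conv_rhs => rw [this, mul_add, ← mul_assoc c p, hcp, zero_mul, add_zero, ← mul_assoc]
  rw [mul_add, add_mul, e1, e2, mul_assoc y, hcp, mul_zero, ← mul_assoc, hc]
  abel

lemma compress_jordan_off (hs : star p = p) (hc : (1 - p) * c = c) :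
    (1 - p) * (c * x + x * star c) * (1 - (1 - p)) = c * x * p := by
  have e : star c * p = 0 := by
    have := congrArg star hc
    simp only [star_mul, star_sub, star_one, hs, mul_sub, mul_one] at this
    simpa using this
  rw [sub_sub_cancel, mul_add, ← mul_assoc, hc, add_mul, mul_assoc, mul_assoc,
    mul_assoc x, e]
  simp

lemma off_jordan_eq_add (hp : p * p = p) (hs : star p = p) (ha : p * a = a)
    (hap : a * p = 0) (hb : p * b = b) (hbp : b * p = 0) :
    p * ((p + a) * (1 - p + b) + (1 - p + b) * star (p + a)) * (1 - p) = a + b := by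
  have g1 : star a * p = star a := by simpa [hs] using congrArg star ha
  have g2 : p * star a = 0 := by simpa [hs] using congrArg star hap
  have g3 : a * b = 0 := by rw [← hb, ← mul_assoc, hap, zero_mul]
  rw [star_add, hs]
  simp only [mul_add, add_mul, mul_sub, sub_mul, one_mul, mul_one, mul_assoc, hp, ha, hap, hb,
    hbp, g1, g2, g3, mul_mul_of_mul_eq hb, mul_zero,
    zero_mul]
  abel

end Peirce

/-- A bijection preserving both `*`-products, together with a projection whose image and the
image of whose complement are complementary and faithful. -/
structure IsPeirceMap {A B : Type*} [Ring A] [StarRing A] [Ring B] [StarRing B]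
    (φ : A → B) (P : A) : Prop where
  bij : Function.Bijective φ
  jordan : ∀ x y, φ (x * y + y * star x) = φ x * φ y + φ y * star (φ x)
  lie : ∀ x y, φ (x * y - y * star x) = φ x * φ y - φ y * star (φ x)
  map_one : φ 1 = 1
  map_double : ∀ x, φ (x + x) = φ x + φ x
  idem : P * P = P
  selfAdjoint : star P = P
  map_compl : φ (1 - P) = 1 - φ P
  faithful : ∀ X : B, (∀ Z, X * Z * φ P = 0) → X = 0
  faithful_compl : ∀ X : B, (∀ Z, X * Z * φ (1 - P) = 0) → X = 0
  torsion : ∀ x : B, x + x = 0 → x = 0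

namespace IsPeirceMap

variable {A B : Type*} [Ring A] [StarRing A] [Ring B] [StarRing B] {φ : A → B} {P : A}

lemma compl (h : IsPeirceMap φ P) : IsPeirceMap φ (1 - P) where
  bij := h.bij
  jordan := h.jordan
  lie := h.lie
  map_one := h.map_one
  map_double := h.map_double
  idem := by simp [mul_sub, sub_mul, h.idem]
  selfAdjoint := by simp [h.selfAdjoint]
  map_compl := by simp [h.map_compl]
  faithful := h.faithful_compl
  faithful_compl := by simpa using h.faithful
  torsion := h.torsion

lemma eq_of_double_eq (h : IsPeirceMap φ P) {x y : B} (hxy : x + x = y + y) : x = y := by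
  refine sub_eq_zero.1 (h.torsion _ ?_)
  rw [sub_add_sub_comm, hxy, sub_self]

lemma map_zero (h : IsPeirceMap φ P) : φ 0 = 0 := by
  obtain ⟨y, hy⟩ := h.bij.2 0
  have := h.jordan 0 y
  simpa [hy] using this

lemma map_mul_of_mul_star_eq_zero (h : IsPeirceMap φ P) {x y : A} (hxy : y * star x = 0) :
    φ (x * y) = φ x * φ y ∧ φ y * star (φ x) = 0 := by
  have h1 := h.jordan x y
  have h2 := h.lie x y
  rw [hxy, add_zero] at h1
  rw [hxy, sub_zero] at h2
  have h3 : φ y * star (φ x) = 0 := by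
    apply h.torsion
    rw [h1] at h2
    calc _ = (φ x * φ y + φ y * star (φ x)) - (φ x * φ y - φ y * star (φ x)) := by abel
      _ = 0 := by rw [h2]; abel
  exact ⟨by rw [h1, h3, add_zero], h3⟩

lemma star_map (h : IsPeirceMap φ P) {x : A} (hx : star x = x) : star (φ x) = φ x := by
  have h1 := h.lie x 1
  simp only [mul_one, one_mul, hx, sub_self, h.map_zero, h.map_one] at h1
  exact (sub_eq_zero.1 h1.symm).symm

lemma star_map_proj (h : IsPeirceMap φ P) : star (φ P) = φ P := h.star_map h.selfAdjoint

lemma map_proj_idem (h : IsPeirceMap φ P) : φ P * φ P = φ P := by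
  have h1 := h.jordan P P
  rw [h.selfAdjoint, h.star_map_proj, h.idem, h.map_double] at h1
  exact (h.eq_of_double_eq h1).symm

lemma map_commute (h : IsPeirceMap φ P) (x : A) :
    φ (P * x - x * P) = φ P * φ x - φ x * φ P := by
  simpa [h.selfAdjoint, h.star_map_proj] using h.lie P x

lemma map_anticommute (h : IsPeirceMap φ P) (x : A) :
    φ (P * x + x * P) = φ P * φ x + φ x * φ P := by
  simpa [h.selfAdjoint, h.star_map_proj] using h.jordan P x

/-- `x` lies in the Peirce corner `P A (1 - P)` iff `φ x` lies in the corresponding corner. -/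
lemma map_mem_off (h : IsPeirceMap φ P) {x : A} :
    (φ P * φ x = φ x ∧ φ x * φ P = 0) ↔ (P * x = x ∧ x * P = 0) := by
  constructor
  · rintro ⟨h1, h2⟩
    have h3 := h.map_anticommute x
    have h4 := h.map_commute x
    rw [h1, h2, add_zero] at h3
    rw [h1, h2, sub_zero] at h4
    have h3 := h.bij.1 h3
    have h4 := h.bij.1 h4
    have h5 : φ (x * P + x * P) = 0 := by
      rw [← h.map_zero]; congr 1
      calc _ = (P * x + x * P) - (P * x - x * P) := by abel
        _ = 0 := by rw [h3, h4, sub_self]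
    rw [h.map_double] at h5
    have h6 : x * P = 0 := h.bij.1 ((h.torsion _ h5).trans h.map_zero.symm)
    exact ⟨by simpa [h6] using h3, h6⟩
  · rintro ⟨h1, h2⟩
    have := h.map_mul_of_mul_star_eq_zero (x := P) (y := x) (by rw [h.selfAdjoint, h2])
    rw [h1, h.star_map_proj] at this
    exact ⟨this.1.symm, this.2⟩

lemma exists_off (h : IsPeirceMap φ P) (z : B) :
    ∃ c, (P * c = c ∧ c * P = 0) ∧ φ c = φ P * z * (1 - φ P) := by
  obtain ⟨c, hc⟩ := h.bij.2 (φ P * z * (1 - φ P))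
  refine ⟨c, h.map_mem_off.1 ?_, hc⟩
  rw [hc]
  exact IsIdempotentElem.off_corner h.map_proj_idem z

/-- Elements annihilated by the whole corner `φ P * B * (1 - φ P)` from the left. -/
lemma eq_zero_of_off_mul (h : IsPeirceMap φ P) {X : B}
    (hX : ∀ c, P * c = c → c * P = 0 → φ c * X = 0) : (1 - φ P) * X = 0 := by
  rw [← star_eq_zero]
  refine h.faithful _ fun Z => ?_
  obtain ⟨c, hc, hcz⟩ := h.exists_off (star Z)
  have := congrArg star (hX c hc.1 hc.2)
  rw [hcz] at this
  simpa [h.star_map_proj, mul_assoc] using this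

lemma map_eq_of_off (h : IsPeirceMap φ P) {y : A} (hy : y = P * y + y * P) :
    φ y = φ P * φ y + φ y * φ P := by
  rw [← h.map_anticommute, ← hy]

/-- For `y` off-diagonal, `φ` respects right multiplication of `P A (1 - P)` by `star y`. -/
lemma map_off_mul_star (h : IsPeirceMap φ P) {y c : A} (hy : y = P * y + y * P)
    (hc : P * c = c) (hcP : c * P = 0) : φ (c * star y) = φ c * star (φ y) := by
  obtain ⟨hd, hdP⟩ := h.map_mem_off.2 ⟨hc, hcP⟩
  have h1 := h.map_anticommute (y * c + c * star y)
  rw [h.jordan, anticommute_jordan_off h.idem h.selfAdjoint hy hc hcP,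
    anticommute_jordan_off h.map_proj_idem h.star_map_proj (h.map_eq_of_off hy) hd hdP, h.map_double] at h1
  exact h.eq_of_double_eq h1

/-- The part of an element in the corner `P A (1 - P)` is respected by `φ`. -/
lemma map_off (h : IsPeirceMap φ P) (x : A) :
    φ (P * x * (1 - P)) = φ P * φ x * (1 - φ P) := by
  have hP := h.idem
  have hQ := h.map_proj_idem
  set y := P * x * (1 - P) + (1 - P) * x * P with hy
  have hyo : y = P * y + y * P := IsIdempotentElem.off_part_eq hP x
  have hT : φ y = φ P * φ x * (1 - φ P) + (1 - φ P) * φ x * φ P := by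
    rw [hy, ← IsIdempotentElem.off_part hP, ← IsIdempotentElem.off_part hQ, ← h.map_compl,
      ← h.map_anticommute, h.compl.map_anticommute]
  set w := P * x * (1 - P) with hw
  have hwm : P * w = w ∧ w * P = 0 := IsIdempotentElem.off_corner hP x
  have hwo : w = P * w + w * P := by rw [hwm.1, hwm.2, add_zero]
  have hwm' := h.map_mem_off.2 hwm
  have key : (1 - φ P) * star (φ y - φ w) = 0 := by
    apply h.eq_zero_of_off_mul
    intro c hc1 hc2
    rw [star_sub, mul_sub, ← h.map_off_mul_star hyo hc1 hc2, ← h.map_off_mul_star hwo hc1 hc2,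
      sub_eq_zero]
    congr 1
    have hs := h.selfAdjoint
    have e1 : y * (1 - P) = w := IsIdempotentElem.off_part_mul hP x
    have e2 : c * (1 - P) = c := by rw [mul_sub, hc2, mul_one, sub_zero]
    calc c * star y = c * (1 - P) * star y := by rw [e2]
      _ = c * star (y * (1 - P)) := by rw [star_mul, star_sub, hs, star_one, mul_assoc]
      _ = _ := by rw [e1]
  have key2 := congrArg star key
  simp only [star_mul, star_star, star_sub, star_one, h.star_map_proj, star_zero] at key2
  have e1 : φ y * (1 - φ P) = φ P * φ x * (1 - φ P) := by
    rw [hT, IsIdempotentElem.off_part_mul hQ]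
  have e2 : φ w * (1 - φ P) = φ w := by rw [mul_sub, mul_one, hwm'.2, sub_zero]
  rw [sub_mul, e1, e2] at key2
  exact (sub_eq_zero.1 key2).symm

/-- Compression of `c * x` for `c` in the corner `(1 - P) A P`. -/
lemma map_off_mul (h : IsPeirceMap φ P) {c : A} (hc : P * c = 0) (hcP : c * P = c) (x : A) :
    φ (c * x * P) = φ c * φ x * φ P := by
  have hP := h.idem
  have hs := h.selfAdjoint
  have hc' : (1 - P) * c = c ∧ c * (1 - P) = 0 := by simp [sub_mul, mul_sub, hc, hcP]
  have hd := h.compl.map_mem_off.2 hc'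
  rw [h.map_compl] at hd
  have h1 := h.compl.map_off (c * x + x * star c)
  rwa [h.jordan, compress_jordan_off hs hc'.1, h.map_compl, compress_jordan_off h.star_map_proj hd.1] at h1

lemma eq_zero_of_off_mul' (h : IsPeirceMap φ P) {X : B}
    (hX : ∀ c, P * c = 0 → c * P = c → φ c * X = 0) : φ P * X = 0 := by
  have := h.compl.eq_zero_of_off_mul (X := X) fun c h1 h2 => hX c
    (by simpa [sub_mul] using h1) (by simpa [mul_sub, sub_eq_zero, eq_comm] using h2)
  simpa [h.map_compl] using this

/-- The part of an element in the corner `P A P` is respected by `φ`. -/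
lemma map_diag (h : IsPeirceMap φ P) (x : A) : φ (P * x * P) = φ P * φ x * φ P := by
  have hP := h.idem
  have h0 : φ P * φ (P * x * P) = φ (P * x * P) ∧ φ (P * x * P) * φ P = φ (P * x * P) := by
    have h1 := h.map_commute (P * x * P)
    have h2 := h.map_anticommute (P * x * P)
    have e1 : P * (P * x * P) = P * x * P := by simp only [← mul_assoc, hP]
    have e2 : P * x * P * P = P * x * P := by simp only [mul_assoc, hP]
    rw [e1, e2, sub_self, h.map_zero, eq_comm, sub_eq_zero] at h1
    rw [e1, e2, h.map_double, h1] at h2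
    have h3 := h.eq_of_double_eq h2
    exact ⟨h1.trans h3.symm, h3.symm⟩
  have key : φ P * (φ x * φ P - φ (P * x * P)) = 0 := by
    apply h.eq_zero_of_off_mul'
    intro c hc hcP
    have h1 := h.map_off_mul hc hcP x
    have h2 := h.map_off_mul hc hcP (P * x * P)
    have e : c * (P * x * P) * P = c * x * P := by
      simp only [mul_assoc, hP]; rw [← mul_assoc, hcP]
    rw [e, mul_assoc (φ c), h0.2] at h2
    rw [mul_sub, ← mul_assoc, ← h1, ← h2, sub_self]
  rw [mul_sub, h0.1, sub_eq_zero, ← mul_assoc] at key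
  exact key.symm

lemma map_peirce (h : IsPeirceMap φ P) (x : A) :
    φ x = φ (P * x * P) + φ (P * x * (1 - P)) +
      (φ ((1 - P) * x * P) + φ ((1 - P) * x * (1 - P))) := by
  have h1 := h.compl.map_off x
  rw [sub_sub_cancel, h.map_compl, sub_sub_cancel] at h1
  rw [h.map_diag, h.map_off, h1, h.compl.map_diag, h.map_compl]
  exact peirce_decomposition _ _

lemma map_add_of_off (h : IsPeirceMap φ P) {a b : A} (ha : P * a = a) (haP : a * P = 0)
    (hb : P * b = b) (hbP : b * P = 0) : φ (a + b) = φ a + φ b := by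
  have hP := h.idem
  have e1 : φ (P + a) = φ P + φ a := by
    rw [h.map_peirce (P + a)]
    have f1 : P * (P + a) * P = P := by simp [mul_add, add_mul, hP, ha, haP]
    have f2 : P * (P + a) * (1 - P) = a := by simp [mul_add, add_mul, mul_sub, hP, ha, haP]
    have f3 : (1 - P) * (P + a) * P = 0 := by simp [mul_add, sub_mul, hP, ha]
    have f4 : (1 - P) * (P + a) * (1 - P) = 0 := by simp [mul_add, mul_sub, sub_mul, hP, ha]
    rw [f1, f2, f3, f4, h.map_zero, add_zero, add_zero]
  have e2 : φ (1 - P + b) = 1 - φ P + φ b := by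
    rw [h.map_peirce (1 - P + b)]
    have f1 : P * (1 - P + b) * P = 0 := by simp [mul_add, mul_sub, hP, hb, hbP]
    have f2 : P * (1 - P + b) * (1 - P) = b := by simp [mul_add, mul_sub, hP, hb, hbP]
    have f3 : (1 - P) * (1 - P + b) * P = 0 := by simp [mul_add, mul_sub, sub_mul, hP, hb]
    have f4 : (1 - P) * (1 - P + b) * (1 - P) = 1 - P := by simp [mul_add, mul_sub, sub_mul, hP, hb]
    rw [f1, f2, f3, f4, h.map_zero, h.map_compl]
    abel
  have h1 := h.map_off ((P + a) * (1 - P + b) + (1 - P + b) * star (P + a))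
  obtain ⟨ha1, ha2⟩ := h.map_mem_off.2 ⟨ha, haP⟩
  obtain ⟨hb1, hb2⟩ := h.map_mem_off.2 ⟨hb, hbP⟩
  rwa [h.jordan, e1, e2, off_jordan_eq_add hP h.selfAdjoint ha haP hb hbP,
    off_jordan_eq_add h.map_proj_idem h.star_map_proj ha1 ha2 hb1 hb2] at h1

lemma off_map_add (h : IsPeirceMap φ P) (x y : A) :
    φ P * φ (x + y) * (1 - φ P) = φ P * (φ x + φ y) * (1 - φ P) := by
  have hP := h.idem
  rw [← h.map_off, mul_add, add_mul, h.map_add_of_off, mul_add, add_mul, ← h.map_off, ← h.map_off]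
  all_goals first
    | exact (IsIdempotentElem.off_corner hP _).1
    | exact (IsIdempotentElem.off_corner hP _).2

lemma diag_map_add (h : IsPeirceMap φ P) (x y : A) :
    φ P * φ (x + y) * φ P = φ P * (φ x + φ y) * φ P := by
  have hP := h.idem
  rw [← sub_eq_zero, mul_assoc, mul_assoc, ← mul_sub, ← sub_mul]
  apply h.eq_zero_of_off_mul'
  intro c hc hcP
  have h1 := h.compl.map_add_of_off (a := c * x * P) (b := c * y * P)
    (by simp [sub_mul, mul_assoc, mul_mul_of_mul_eq hc]) (by simp [mul_sub, mul_assoc, hP])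
    (by simp [sub_mul, mul_assoc, mul_mul_of_mul_eq hc]) (by simp [mul_sub, mul_assoc, hP])
  rw [← add_mul, ← mul_add, h.map_off_mul hc hcP, h.map_off_mul hc hcP, h.map_off_mul hc hcP] at h1
  rw [sub_mul, mul_sub, ← mul_assoc, h1]
  noncomm_ring

lemma map_add (h : IsPeirceMap φ P) (x y : A) : φ (x + y) = φ x + φ y := by
  have h1 := h.compl.off_map_add x y
  have h2 := h.compl.diag_map_add x y
  rw [h.map_compl] at h1 h2
  rw [sub_sub_cancel] at h1
  rw [peirce_decomposition (φ P) (φ (x + y)), h1, h2, h.off_map_add, h.diag_map_add, ← peirce_decomposition]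

lemma map_star (h : IsPeirceMap φ P) (x : A) : φ (star x) = star (φ x) := by
  simpa [h.map_one, h.map_add] using h.jordan x 1

end IsPeirceMap

section Complex

section Module

variable {A : Type*} [AddCommGroup A] [Module ℂ A]

lemma half_smul_add_self (x : A) : (2⁻¹ : ℂ) • (x + x) = x := by
  rw [← two_smul ℂ x, smul_smul]; norm_num

lemma half_smul_injective : Function.Injective fun x : A => (2⁻¹ : ℂ) • x :=
  smul_right_injective A (by norm_num)

lemma half_smul_eq_zero {x : A} : (2⁻¹ : ℂ) • x = 0 ↔ x = 0 := by
  simp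

lemma eq_zero_of_add_self_eq_zero {x : A} (hx : x + x = 0) : x = 0 := by
  rw [← half_smul_add_self x, hx, smul_zero]

lemma two_pow_smul_injective (k : ℕ) : Function.Injective fun x : A => (2 ^ k : ℂ) • x :=
  smul_right_injective A (by norm_num)

end Module

section Fold

variable {A : Type*} [Ring A] [StarRing A] [Algebra ℂ A]

lemma foldl_jordanStar_replicate_one {x : A} (hx : star x = x) (k : ℕ) :
    (List.replicate k (1 : A)).foldl jordanStar x = (2 ^ k : ℂ) • x := by
  induction k generalizing x with
  | zero => simp
  | succ k ih =>
    rw [List.replicate_succ, List.foldl_cons, ih (by simp [jordanStar, add_comm])]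
    simp [jordanStar, hx, ← two_smul ℂ x, smul_smul, pow_succ]

lemma foldl_lieStar_replicate_one {x : A} (hx : star x = -x) (k : ℕ) :
    (List.replicate k (1 : A)).foldl lieStar x = (2 ^ k : ℂ) • x := by
  induction k generalizing x with
  | zero => simp
  | succ k ih =>
    rw [List.replicate_succ, List.foldl_cons, ih (by simp [lieStar])]
    simp [lieStar, hx, ← two_smul ℂ x, smul_smul, pow_succ]

end Fold

section Mul

variable {A B : Type*} [Ring A] [StarRing A] [Algebra ℂ A] [Ring B] [StarRing B]

lemma IsPeirceMap.map_mul [StarModule ℂ A] {φ : A → B} {P : A} (h : IsPeirceMap φ P)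
    (hI : ∀ y, φ (Complex.I • y) = φ (Complex.I • 1) * φ y) (x y : A) :
    φ (x * y) = φ x * φ y := by
  have hsa : ∀ {x : A}, star x = x → ∀ y, φ (x * y) = φ x * φ y := by
    intro x hx y
    have h1 := h.jordan x y
    have h2 := h.lie x y
    apply h.eq_of_double_eq
    rw [← h.map_double]
    have := congrArg₂ (· + ·) h1 h2
    simp only [← h.map_add] at this
    rw [show x * y + y * star x + (x * y - y * star x) = x * y + x * y by abel] at this
    rw [this]
    abel
  have hx := realPart_add_I_smul_imaginaryPart x
  have hre : star (realPart x : A) = realPart x := (realPart x).2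
  have him : star (imaginaryPart x : A) = imaginaryPart x := (imaginaryPart x).2
  rw [← hx, add_mul, h.map_add, h.map_add, add_mul, smul_mul_assoc, hI, hI (imaginaryPart x : A),
    hsa hre, hsa him, mul_assoc]

end Mul

variable {A B : Type*} [Ring A] [StarRing A] [Algebra ℂ A]
  [Ring B] [StarRing B] [Algebra ℂ B]

/-- A unital bijection preserving the halves of both `*`-products. -/
structure IsHalfLieJordanMap (φ : A → B) : Prop where
  bij : Function.Bijective φ
  map_one : φ 1 = 1
  jordan : ∀ x y, φ ((2⁻¹ : ℂ) • (x * y + y * star x)) =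
    (2⁻¹ : ℂ) • (φ x * φ y + φ y * star (φ x))
  lie : ∀ x y, φ ((2⁻¹ : ℂ) • (x * y - y * star x)) =
    (2⁻¹ : ℂ) • (φ x * φ y - φ y * star (φ x))

namespace IsHalfLieJordanMap

variable {φ : A → B} {P : A}

lemma map_zero_of_jordan (hφ : Function.Surjective φ)
    (hJ : ∀ x y, φ ((2⁻¹ : ℂ) • (x * y + y * star x)) =
      (2⁻¹ : ℂ) • (φ x * φ y + φ y * star (φ x))) : φ 0 = 0 := by
  obtain ⟨y, hy⟩ := hφ 0
  simpa [hy] using hJ 0 y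

lemma map_zero (h : IsHalfLieJordanMap φ) : φ 0 = 0 := map_zero_of_jordan h.bij.2 h.jordan

lemma star_map (h : IsHalfLieJordanMap φ) {x : A} (hx : star x = x) : star (φ x) = φ x := by
  have h1 := h.lie x 1
  simp only [mul_one, one_mul, hx, sub_self, smul_zero, h.map_zero, h.map_one] at h1
  exact (sub_eq_zero.1 (half_smul_eq_zero.1 h1.symm)).symm

lemma jordan_of_star_eq (h : IsHalfLieJordanMap φ) {x : A} (hx : star x = x) (y : A) :
    φ ((2⁻¹ : ℂ) • (x * y + y * x)) = (2⁻¹ : ℂ) • (φ x * φ y + φ y * φ x) := by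
  simpa [hx, h.star_map hx] using h.jordan x y

lemma lie_of_star_eq (h : IsHalfLieJordanMap φ) {x : A} (hx : star x = x) (y : A) :
    φ ((2⁻¹ : ℂ) • (x * y - y * x)) = (2⁻¹ : ℂ) • (φ x * φ y - φ y * φ x) := by
  simpa [hx, h.star_map hx] using h.lie x y

lemma map_proj_idem (h : IsHalfLieJordanMap φ) (hP : P * P = P) (hs : star P = P) :
    φ P * φ P = φ P := by
  have h1 := h.jordan_of_star_eq hs P
  rw [hP, half_smul_add_self, half_smul_add_self] at h1
  exact h1.symm

/-- `x` is fixed by left multiplication with a projection if its image is fixed by both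
multiplications with the image of the projection. -/
lemma mul_eq_of_jordan_lie (h : IsHalfLieJordanMap φ) {p x z : A} (hp : star p = p)
    (hJ : (2⁻¹ : ℂ) • (φ p * φ x + φ x * φ p) = φ z)
    (hL : (2⁻¹ : ℂ) • (φ p * φ x - φ x * φ p) = 0) : p * x = z := by
  rw [← h.jordan_of_star_eq hp] at hJ
  rw [← h.lie_of_star_eq hp, ← h.map_zero] at hL
  have hJ := h.bij.1 hJ
  have hL := sub_eq_zero.1 (half_smul_eq_zero.1 (h.bij.1 hL))
  rw [← hL, half_smul_add_self] at hJ
  exact hJ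

lemma map_proj_mul_map_compl (h : IsHalfLieJordanMap φ) (hP : P * P = P) (hs : star P = P) :
    φ P * φ (1 - P) = 0 ∧ φ (1 - P) * φ P = 0 := by
  have e1 : P * (1 - P) = 0 := by simp [mul_sub, hP]
  have e2 : (1 - P) * P = 0 := by simp [sub_mul, hP]
  have h1 := h.jordan_of_star_eq hs (1 - P)
  have h2 := h.lie_of_star_eq hs (1 - P)
  rw [e1, e2, add_zero, smul_zero, h.map_zero, eq_comm, half_smul_eq_zero] at h1
  rw [e1, e2, sub_zero, smul_zero, h.map_zero, eq_comm, half_smul_eq_zero, sub_eq_zero] at h2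
  rw [← h2] at h1
  exact ⟨eq_zero_of_add_self_eq_zero h1, h2 ▸ eq_zero_of_add_self_eq_zero h1⟩

lemma map_compl (h : IsHalfLieJordanMap φ) (hP : P * P = P) (hs : star P = P) :
    φ (1 - P) = 1 - φ P := by
  have hP' : (1 - P) * (1 - P) = 1 - P := by simp [mul_sub, sub_mul, hP]
  have hs' : star (1 - P) = 1 - P := by simp [hs]
  obtain ⟨o1, o2⟩ := h.map_proj_mul_map_compl hP hs
  have i1 := h.map_proj_idem hP hs
  have i2 := h.map_proj_idem hP' hs'
  obtain ⟨T, hT⟩ := h.bij.2 (φ P + φ (1 - P))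
  have t1 : P * T = P := h.mul_eq_of_jordan_lie hs
    (by rw [hT, mul_add, add_mul, i1, o1, o2, add_zero, half_smul_add_self])
    (by rw [hT, mul_add, add_mul, i1, o1, o2, sub_self, smul_zero])
  have t2 : (1 - P) * T = 1 - P := h.mul_eq_of_jordan_lie hs'
    (by rw [hT, mul_add, add_mul, i2, o1, o2, zero_add, half_smul_add_self])
    (by rw [hT, mul_add, add_mul, i2, o1, o2, sub_self, smul_zero])
  have t3 : T = 1 := by
    calc T = P * T + (1 - P) * T := by noncomm_ring
      _ = 1 := by rw [t1, t2]; abel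
  rw [t3, h.map_one] at hT
  exact (sub_eq_of_eq_add' hT).symm

lemma map_two_mul_map_proj (h : IsHalfLieJordanMap φ) (hP : P * P = P) (hs : star P = P)
    (hd : ∀ y, φ (y + y) = φ (1 + 1) * φ y)
    (hf : ∀ X : B, (∀ Z, X * Z * φ (1 - P) = 0) → X = 0) :
    φ (1 + 1) * φ P = (1 + 1) * φ P := by
  have hc := h.map_compl hP hs
  have hs' : star (1 - P) = 1 - P := by simp [hs]
  have i1 := h.map_proj_idem hP hs
  rw [← sub_eq_zero, ← sub_mul]
  refine hf _ fun Z => ?_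
  rw [hc]
  obtain ⟨y, hy⟩ := h.bij.2 (φ P * Z * (1 - φ P))
  obtain ⟨z1, z2⟩ := IsIdempotentElem.off_corner i1 Z
  rw [← hy] at z1 z2
  have hJ := h.jordan_of_star_eq hs y
  have hL := h.lie_of_star_eq hs y
  have hJ' := h.jordan_of_star_eq hs' y
  rw [z1, z2, add_zero] at hJ
  rw [z1, z2, sub_zero] at hL
  rw [hc, sub_mul _ _ (φ y), mul_sub (φ y), z1, z2, one_mul (φ y), mul_one (φ y), sub_self, sub_zero, zero_add] at hJ'
  have k1 := half_smul_injective (h.bij.1 (hJ.trans hL.symm))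
  have k2 := half_smul_injective (h.bij.1 (hJ.trans hJ'.symm))
  have yP : y * P = 0 := by
    apply eq_zero_of_add_self_eq_zero (A := A)
    calc y * P + y * P = (P * y + y * P) - (P * y - y * P) := by abel
      _ = 0 := by rw [k1, sub_self]
  have Py : P * y = y := by
    rw [← sub_eq_zero]
    apply eq_zero_of_add_self_eq_zero (A := A)
    simp only [yP, add_zero, sub_mul, mul_sub, one_mul, mul_one, sub_zero] at k2
    nth_rewrite 1 [k2]
    abel
  rw [Py, yP, add_zero] at hJ
  have hy2 := hd ((2⁻¹ : ℂ) • y)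
  rw [← smul_add, half_smul_add_self, hJ, mul_smul_comm] at hy2
  have hy3 : φ (1 + 1) * φ y = (1 + 1) * φ y := by
    conv_rhs => rw [hy2]
    rw [add_mul, one_mul, ← smul_add, half_smul_add_self]
  rw [hy] at hy3
  have : (φ (1 + 1) - (1 + 1)) * φ P * Z * (1 - φ P) =
      φ (1 + 1) * (φ P * Z * (1 - φ P)) - (1 + 1) * (φ P * Z * (1 - φ P)) := by
    simp only [sub_mul, mul_assoc]
  rw [this, hy3, sub_self]

lemma map_double (h : IsHalfLieJordanMap φ) (hP : P * P = P) (hs : star P = P)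
    (hf : ∀ X : B, (∀ Z, X * Z * φ P = 0) → X = 0)
    (hf' : ∀ X : B, (∀ Z, X * Z * φ (1 - P) = 0) → X = 0) (y : A) : φ (y + y) = φ y + φ y := by
  have hd : ∀ y, φ (y + y) = φ (1 + 1) * φ y := by
    intro y
    have h2 : star (1 + 1 : A) = 1 + 1 := by simp
    have hJ := h.jordan_of_star_eq h2 y
    have hL := h.lie_of_star_eq h2 y
    have e : (1 + 1) * y = y * (1 + 1) := by simp [mul_add, add_mul]
    rw [e, sub_self, smul_zero, h.map_zero, eq_comm, half_smul_eq_zero, sub_eq_zero] at hL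
    rw [e, ← hL, half_smul_add_self, half_smul_add_self, mul_add, mul_one] at hJ
    exact hJ
  have hP' : (1 - P) * (1 - P) = 1 - P := by simp [mul_sub, sub_mul, hP]
  have hs' : star (1 - P) = 1 - P := by simp [hs]
  have e1 := h.map_two_mul_map_proj hP hs hd hf'
  have e2 := h.map_two_mul_map_proj hP' hs' hd (by simpa using hf)
  rw [h.map_compl hP hs] at e2
  have e3 : φ (1 + 1) = 1 + 1 := by
    calc φ (1 + 1) = φ (1 + 1) * φ P + φ (1 + 1) * (1 - φ P) := by noncomm_ring
      _ = 1 + 1 := by rw [e1, e2]; noncomm_ring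
  rw [hd, e3, add_mul, one_mul]

lemma isPeirceMap (h : IsHalfLieJordanMap φ) (hP : P * P = P) (hs : star P = P)
    (hf : ∀ X : B, (∀ Z, X * Z * φ P = 0) → X = 0)
    (hf' : ∀ X : B, (∀ Z, X * Z * φ (1 - P) = 0) → X = 0) : IsPeirceMap φ P where
  bij := h.bij
  jordan x y := by
    have := h.map_double hP hs hf hf' ((2⁻¹ : ℂ) • (x * y + y * star x))
    rwa [← smul_add, half_smul_add_self, h.jordan, ← smul_add, half_smul_add_self] at this
  lie x y := by
    have := h.map_double hP hs hf hf' ((2⁻¹ : ℂ) • (x * y - y * star x))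
    rwa [← smul_add, half_smul_add_self, h.lie, ← smul_add, half_smul_add_self] at this
  map_one := h.map_one
  map_double := h.map_double hP hs hf hf'
  idem := hP
  selfAdjoint := hs
  map_compl := h.map_compl hP hs
  faithful := hf
  faithful_compl := hf'
  torsion _ := eq_zero_of_add_self_eq_zero

lemma of_jordan_of_map_I_smul [StarModule ℂ A] (hbij : Function.Bijective φ) (hφ1 : φ 1 = 1)
    (hJ : ∀ x y, φ ((2⁻¹ : ℂ) • (x * y + y * star x)) =
      (2⁻¹ : ℂ) • (φ x * φ y + φ y * star (φ x)))
    (hI : ∀ y, φ (Complex.I • y) = φ (Complex.I • 1) * φ y)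
    (hIs : star (φ (Complex.I • 1)) = -φ (Complex.I • 1))
    (hIc : ∀ b, φ (Complex.I • 1) * b = b * φ (Complex.I • 1)) : IsHalfLieJordanMap φ where
  bij := hbij
  map_one := hφ1
  jordan := hJ
  lie x y := by
    set j := φ (Complex.I • 1)
    have hj4 : j * (j * (j * j)) = 1 := by
      rw [← hφ1, ← hI, ← hI, ← hI]
      simp [smul_smul]
    have key := hJ (Complex.I • x) y
    have e : (2⁻¹ : ℂ) • (Complex.I • x * y + y * star (Complex.I • x)) =
        Complex.I • (2⁻¹ : ℂ) • (x * y - y * star x) := by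
      rw [smul_comm, star_smul]
      simp [sub_eq_add_neg]
    rw [e, hI, hI, star_mul, hIs, mul_neg, mul_neg, ← sub_eq_add_neg, mul_assoc, ← mul_assoc (φ y),
      ← hIc, ← mul_sub, ← mul_smul_comm] at key
    have := congrArg (fun t => j * (j * (j * t))) key
    simpa only [← mul_assoc, (by simpa only [← mul_assoc] using hj4 : j * j * j * j = 1),
      one_mul] using this

end IsHalfLieJordanMap

variable [StarModule ℂ A] [StarModule ℂ B]

lemma qStar_replicate_one_append {x : A} (hx : star x = x) (k : ℕ) (y : A) :
    qStar x (List.replicate k 1 ++ [y]) = (2 ^ k : ℂ) • (x * y + y * x) := by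
  simp [qStar, foldl_jordanStar_replicate_one hx, jordanStar, hx, smul_add]

lemma qStar_one_replicate_one_append (k : ℕ) (x y : A) :
    qStar 1 (List.replicate k 1 ++ [x, y]) = (2 ^ (k + 1) : ℂ) • (x * y + y * star x) := by
  have : jordanStar ((2 ^ k : ℂ) • 1) x = (2 ^ (k + 1) : ℂ) • x := by
    simp [jordanStar, ← smul_add, ← two_smul ℂ x, smul_smul, pow_succ]
  simp [qStar, foldl_jordanStar_replicate_one, this]
  simp [jordanStar]

lemma pStar_replicate_one_append {x : A} (hx : star x = -x) (k : ℕ) (y : A) :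
    pStar x (List.replicate k 1 ++ [y]) = (2 ^ k : ℂ) • (x * y + y * x) := by
  simp [pStar, foldl_lieStar_replicate_one hx, lieStar, hx, smul_add]

/-- A unital bijection preserving both `n`-fold `*`-products, `n = k + 2`, preserves the halves of
the binary ones and is compatible with multiplication by `I`. -/
lemma isHalfLieJordanMap_of_preserves {φ : A → B} (k : ℕ) (hbij : Function.Bijective φ)
    (hφ1 : φ 1 = 1)
    (hp : ∀ (x : A) (l : List A), l.length = k + 1 → φ (pStar x l) = pStar (φ x) (l.map φ))
    (hq : ∀ (x : A) (l : List A), l.length = k + 1 → φ (qStar x l) = qStar (φ x) (l.map φ)) :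
    IsHalfLieJordanMap φ ∧ ∀ y, φ (Complex.I • y) = φ (Complex.I • 1) * φ y := by
  have hscale : ∀ y, φ ((2 ^ (k + 1) : ℂ) • y) = (2 ^ (k + 1) : ℂ) • φ y := by
    intro y
    have := hq 1 (List.replicate k 1 ++ [y]) (by simp)
    rw [List.map_append, List.map_replicate, hφ1, List.map_singleton,
      qStar_replicate_one_append (star_one _), qStar_replicate_one_append (star_one _)] at this
    simpa [← two_smul ℂ, smul_smul, pow_succ] using this
  have hJk : ∀ x y, φ ((2 ^ k : ℂ) • (x * y + y * star x)) =
      (2 ^ k : ℂ) • (φ x * φ y + φ y * star (φ x)) := by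
    intro x y
    rcases k with _ | k
    · simpa [qStar, jordanStar] using hq x [y] (by simp)
    · have := hq 1 (List.replicate k 1 ++ [x, y]) (by simp)
      rw [List.map_append, List.map_replicate, hφ1] at this
      simpa only [List.map_cons, List.map_nil, qStar_one_replicate_one_append] using this
  have hJ : ∀ x y, φ ((2⁻¹ : ℂ) • (x * y + y * star x)) =
      (2⁻¹ : ℂ) • (φ x * φ y + φ y * star (φ x)) := by
    intro x y
    apply two_pow_smul_injective (A := B) (k + 1)
    have e : (2 ^ (k + 1) * 2⁻¹ : ℂ) = 2 ^ k := by rw [pow_succ]; ring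
    simp only [← hscale, smul_smul, e, hJk]
  have h0 : φ 0 = 0 := IsHalfLieJordanMap.map_zero_of_jordan hbij.2 hJ
  set j := φ (Complex.I • 1) with hj
  have hanti : ∀ b, j * b + b * star j = 0 := by
    intro b
    obtain ⟨y, rfl⟩ := hbij.2 b
    have := hJ (Complex.I • 1) y
    rw [← hj] at this
    rw [← half_smul_eq_zero, ← this]
    simp [star_smul, h0]
  have hIs : star j = -j := by
    have := hanti 1
    rw [mul_one, one_mul] at this
    exact (neg_eq_of_add_eq_zero_right this).symm
  have hIc : ∀ b, j * b = b * j := by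
    intro b
    have := hanti b
    rwa [hIs, mul_neg, ← sub_eq_add_neg, sub_eq_zero] at this
  have hI : ∀ y, φ (Complex.I • y) = j * φ y := by
    intro y
    have := hp (Complex.I • 1) (List.replicate k 1 ++ [y]) (by simp)
    rw [List.map_append, List.map_replicate, hφ1, List.map_singleton, ← hj,
      pStar_replicate_one_append (by simp [star_smul]), pStar_replicate_one_append hIs, ← hIc] at this
    apply two_pow_smul_injective (A := B) (k + 1)
    simp only [← hscale]
    simpa [← two_smul ℂ, smul_smul, pow_succ, mul_assoc] using this
  exact ⟨IsHalfLieJordanMap.of_jordan_of_map_I_smul hbij hφ1 hJ hI hIs hIc, hI⟩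

end Complex

lemma List.map_foldl_of_hom {α β : Type*} {φ : α → β} {f : α → α → α} {g : β → β → β}
    (h : ∀ x y, φ (f x y) = g (φ x) (φ y)) (x : α) (l : List α) :
    φ (l.foldl f x) = (l.map φ).foldl g (φ x) := by
  induction l generalizing x with
  | nil => rfl
  | cons a l ih => simp [ih, h]

/-- Main theorem: under (†), a bijective unital map is a multiplicative *-Lie-Jordan
n-map iff it is a *-ring isomorphism. -/
theorem starLieJordanMap_iff_starRingIso {A B : Type*} [NormedRing A] [StarRing A] [CStarRing A] [NormedAlgebra ℂ A] [CompleteSpace A] [StarModule ℂ A] [NormedRing B] [StarRing B] [CStarRing B] [NormedAlgebra ℂ B] [CompleteSpace B] [StarModule ℂ B]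
    (n : ℕ) (hn : 2 ≤ n) (φ : A → B) (hbij : Function.Bijective φ) (hφ1 : φ 1 = 1)
    (P : A) (hPidem : P * P = P) (hPsa : star P = P) (hP0 : P ≠ 0) (hP1 : P ≠ 1)
    (hdag : ∀ Pi : A, (Pi = P ∨ Pi = 1 - P) →
      ∀ X : B, (∀ Z : B, X * Z * φ Pi = 0) → X = 0) :
    ((∀ (x : A) (l : List A), l.length = n - 1 → φ (pStar x l) = pStar (φ x) (l.map φ)) ∧
     (∀ (x : A) (l : List A), l.length = n - 1 → φ (qStar x l) = qStar (φ x) (l.map φ)))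
    ↔ ((∀ x y : A, φ (x + y) = φ x + φ y) ∧ (∀ x y : A, φ (x * y) = φ x * φ y) ∧
       (∀ x : A, φ (star x) = star (φ x))) := by
  constructor
  · rintro ⟨hp, hq⟩
    obtain ⟨k, rfl⟩ := Nat.exists_eq_add_of_le' hn
    obtain ⟨hhalf, hI⟩ := isHalfLieJordanMap_of_preserves k hbij hφ1 hp hq
    have hPeirce := hhalf.isPeirceMap hPidem hPsa (hdag P (Or.inl rfl)) (hdag (1 - P) (Or.inr rfl))
    exact ⟨hPeirce.map_add, hPeirce.map_mul hI, hPeirce.map_star⟩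
  · rintro ⟨hadd, hmul, hstar⟩
    have hsub : ∀ x y, φ (x - y) = φ x - φ y := fun x y => by
      rw [eq_sub_iff_add_eq, ← hadd, sub_add_cancel]
    exact ⟨fun x l _ => List.map_foldl_of_hom (by simp [lieStar, hsub, hmul, hstar]) x l,
      fun x l _ => List.map_foldl_of_hom (by simp [jordanStar, hadd, hmul, hstar]) x l⟩
end

section
/- Let A be a unital C*-algebra, A' a prime unital C*-algebra (meaning X A' Y = {0} implies X = 0 or Y = 0), and P₁ a nontrivial projection in A with P₂ = I - P₁. Then a bijective unital map φ: A → A' is a multiplicative *-Lie-Jordan n-map if and only if φ is a *-ring isomorphism. -/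
section Folds

variable {R : Type*} [Ring R] [StarRing R] [Algebra ℂ R] [StarModule ℂ R]

theorem pStar_replicate_one {x : R} (hx : star x = -x) (m : ℕ) :
    pStar x (List.replicate m 1) = (2 : ℂ) ^ m • x := by
  induction m with
  | zero => simp [pStar]
  | succ m ih =>
    rw [List.replicate_succ', pStar, List.foldl_append]
    change lieStar (pStar x _) 1 = _
    rw [ih]
    simp [lieStar, hx, pow_succ', mul_smul, two_smul]

theorem pStar_replicate_succ_one (x : R) (m : ℕ) :
    pStar x (List.replicate (m + 1) 1) = (2 : ℂ) ^ m • (x - star x) := by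
  rw [← pStar_replicate_one (x := x - star x) (by simp)]
  simp [pStar, List.replicate_succ, lieStar]

theorem qStar_one_replicate_one (m : ℕ) :
    qStar (1 : R) (List.replicate m 1) = (2 : ℂ) ^ m • 1 := by
  induction m with
  | zero => simp [qStar]
  | succ m ih =>
    rw [List.replicate_succ', qStar, List.foldl_append]
    change jordanStar (qStar 1 _) 1 = _
    rw [ih]
    simp [jordanStar, pow_succ', mul_smul, two_smul]

theorem pStar_replicate_one_concat {x : R} (hx : star x = -x) (y : R) (m : ℕ) :
    pStar x (List.replicate m 1 ++ [y]) = (2 : ℂ) ^ m • (x * y + y * x) := by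
  rw [pStar, List.foldl_append]
  change lieStar (pStar x _) y = _
  rw [pStar_replicate_one hx]
  simp [lieStar, hx]

theorem qStar_one_replicate_one_concat (x y : R) (m : ℕ) :
    qStar 1 (List.replicate m 1 ++ [x, y]) = (2 : ℂ) ^ (m + 1) • jordanStar x y := by
  rw [qStar, List.foldl_append]
  change jordanStar (jordanStar (qStar 1 _) x) y = _
  rw [qStar_one_replicate_one]
  simp only [jordanStar]
  simp [pow_succ, mul_smul, two_smul, add_mul, mul_add]

end Folds

theorem map_foldl {A B : Type*} (φ : A → B) (f : A → A → A) (g : B → B → B)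
    (h : ∀ x y, φ (f x y) = g (φ x) (φ y)) (x : A) (l : List A) :
    φ (l.foldl f x) = (l.map φ).foldl g (φ x) := by
  induction l generalizing x with
  | nil => rfl
  | cons y l ih => simp [ih, h]

theorem sq_eq_two_of_pow_eq {B : Type*} [CStarAlgebra B] {u : B} (hu : star u = u) {M : ℕ}
    (hM : M ≠ 0) (h : (u ^ 2) ^ M = 2 ^ M) : u ^ 2 = 2 := by
  let := CStarAlgebra.spectralOrder B
  let := CStarAlgebra.spectralOrderedRing B
  set d : B := u ^ 2 - 2 with hd
  have hdu : Commute d u := by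
    refine Commute.sub_left ((Commute.refl u).pow_left 2) (Commute.ofNat_left 2 u)
  have hds : star d = d := by simp [hd, hu]
  have hgeom : (∑ j ∈ Finset.range M, (u ^ 2) ^ j * 2 ^ (M - 1 - j)) * d = 0 := by
    rw [hd, (Commute.ofNat_right (u ^ 2) 2).geom_sum₂_mul, h, sub_self]
  have hterm : ∀ j, d * ((u ^ 2) ^ j * 2 ^ (M - 1 - j)) * d
      = (2 ^ (M - 1 - j) : ℕ) • ((d * u ^ j) * star (d * u ^ j)) := by
    intro j
    have h2 : ((u ^ 2) ^ j * 2 ^ (M - 1 - j) : B)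
        = (2 ^ (M - 1 - j) : ℕ) • (u ^ j * u ^ j) := by
      rw [nsmul_eq_mul, ← pow_mul, two_mul, pow_add]
      push_cast
      exact ((Commute.ofNat_right _ 2).pow_right _).eq
    rw [h2, star_mul, star_pow, hu, hds, mul_smul_comm, smul_mul_assoc]
    simp only [mul_assoc]
  have hsum : ∑ j ∈ Finset.range M,
      (2 ^ (M - 1 - j) : ℕ) • ((d * u ^ j) * star (d * u ^ j)) = 0 := by
    rw [← Finset.sum_congr rfl fun j _ => hterm j, ← Finset.sum_mul, ← Finset.mul_sum,
      mul_assoc, hgeom, mul_zero]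
  have h0 := (Finset.sum_eq_zero_iff_of_nonneg
    (fun j _ => nsmul_nonneg (mul_star_self_nonneg (d * u ^ j)) _)).1 hsum 0
    (Finset.mem_range.2 (Nat.pos_of_ne_zero hM))
  have h1 : (d * u ^ 0) * star (d * u ^ 0) = 0 := by
    rw [← Nat.cast_smul_eq_nsmul ℂ] at h0
    exact (smul_eq_zero.1 h0).resolve_left (by simp)
  rw [CStarRing.mul_star_self_eq_zero_iff] at h1
  exact sub_eq_zero.1 (by simpa using h1)

section Additive

variable {R S : Type*} [Ring R] [Ring S]

theorem eq_zero_of_peirce {e w : R} (he : e * e = e) (h11 : e * w * e = 0)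
    (h22 : (1 - e) * w * (1 - e) = 0) (hoff : e * (e * w - w * e) - (e * w - w * e) * e = 0) :
    w = 0 := by
  have h12 : w = e * w * e + (1 - e) * w * (1 - e)
      + (e * (e * w - w * e) - (e * w - w * e) * e) := by
    have h1 : e * (e * w) = e * w := by rw [← mul_assoc, he]
    have h2 : w * e * e = w * e := by rw [mul_assoc, he]
    simp only [mul_sub, sub_mul, one_mul, mul_one, h1, h2, ← mul_assoc]
    rw [h11]
    abel
  rw [h12, h11, h22, hoff]; simp

variable [StarRing R] [StarRing S]

/-- A bijection preserving the Jordan *-product and the commutators with self-adjoint elements. -/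
structure IsJordanLieMap (ψ : R → S) : Prop where
  bijective : Function.Bijective ψ
  map_zero : ψ 0 = 0
  jordan : ∀ x y, ψ (jordanStar x y) = jordanStar (ψ x) (ψ y)
  lie : ∀ h y, star h = h → ψ (h * y - y * h) = ψ h * ψ y - ψ y * ψ h
  selfAdjoint : ∀ h, star h = h → star (ψ h) = ψ h

theorem corner_eq_zero {e w : R} (hprime : ∀ X Y : R, (∀ Z, X * Z * Y = 0) → X = 0 ∨ Y = 0)
    (he : e * e = e) (hes : star e = e) (he1 : e ≠ 1)
    (hw : ∀ t, e * t = 0 → t * e = t → e * w * star t + t * w * e = 0) : e * w * e = 0 := by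
  refine (hprime (e * w * e) (1 - e) fun Z => ?_).resolve_right (sub_ne_zero.2 he1.symm)
  have h0 : e * (1 - e) = 0 := by rw [mul_sub, mul_one, he, sub_self]
  have h1 : e * ((1 - e) * star Z * e) = 0 := by simp only [← mul_assoc, h0, zero_mul]
  have h := congrArg (e * ·) (hw ((1 - e) * star Z * e) h1 (by rw [mul_assoc, he]))
  simp only [mul_add, mul_zero] at h
  rw [← mul_assoc e (_ * _) e, ← mul_assoc e _ w, h1] at h
  simpa [← mul_assoc, he, hes] using h

namespace IsJordanLieMap

variable {ψ : R → S}

theorem jordan_selfAdjoint (hψ : IsJordanLieMap ψ) {h : R} (hh : star h = h) (y : R) :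
    ψ (h * y + y * h) = ψ h * ψ y + ψ y * ψ h := by
  simpa [jordanStar, hh, hψ.selfAdjoint h hh] using hψ.jordan h y

theorem map_corner (hψ : IsJordanLieMap ψ) {e t : R} (he : e * e = e) (hes : star e = e)
    (het : e * t = 0) (y : R) :
    ψ (e * y * star t + t * y * e) =
      ψ e * (ψ e * jordanStar (ψ t) (ψ y) - jordanStar (ψ t) (ψ y) * ψ e)
        - (ψ e * jordanStar (ψ t) (ψ y) - jordanStar (ψ t) (ψ y) * ψ e) * ψ e := by
  rw [← hψ.jordan, ← hψ.lie e _ hes, ← hψ.lie e _ hes]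
  congr 1
  have h1 : star t * e = 0 := by rw [← hes, ← star_mul, het, star_zero]
  simp only [jordanStar, mul_add, add_mul, mul_sub, sub_mul, ← mul_assoc, he, het, zero_mul]
  simp only [mul_assoc, he, h1, mul_zero, zero_mul]
  abel

/-- Additivity of `ψ` on `a, b` may be tested after applying the operators that detect the Peirce
components. -/
theorem map_add_of_peirce (hψ : IsJordanLieMap ψ)
    (hprime : ∀ X Y : R, (∀ Z, X * Z * Y = 0) → X = 0 ∨ Y = 0)
    {e : R} (he : e * e = e) (hes : star e = e) (he0 : e ≠ 0) (he1 : e ≠ 1) {a b : R}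
    (hoff : ψ (e * (e * (a + b) - (a + b) * e) - (e * (a + b) - (a + b) * e) * e) =
      ψ (e * (e * a - a * e) - (e * a - a * e) * e)
        + ψ (e * (e * b - b * e) - (e * b - b * e) * e))
    (h11 : ∀ t, e * t = 0 → t * e = t → ψ (e * (a + b) * star t + t * (a + b) * e) =
      ψ (e * a * star t + t * a * e) + ψ (e * b * star t + t * b * e))
    (h22 : ∀ t, (1 - e) * t = 0 → t * (1 - e) = t →
      ψ ((1 - e) * (a + b) * star t + t * (a + b) * (1 - e)) =
      ψ ((1 - e) * a * star t + t * a * (1 - e)) + ψ ((1 - e) * b * star t + t * b * (1 - e))) :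
    ψ (a + b) = ψ a + ψ b := by
  obtain ⟨y, hy⟩ := hψ.bijective.surjective (ψ a + ψ b)
  have hf : (1 - e) * (1 - e) = 1 - e := by simp [mul_sub, sub_mul, he]
  have hfs : star (1 - e) = 1 - e := by simp [hes]
  have corner : ∀ g : R, g * g = g → star g = g → g ≠ 1 →
      (∀ t, g * t = 0 → t * g = t → ψ (g * (a + b) * star t + t * (a + b) * g) =
        ψ (g * a * star t + t * a * g) + ψ (g * b * star t + t * b * g)) →
      g * (y - (a + b)) * g = 0 := by
    intro g hg hgs hg1 hadd
    refine corner_eq_zero hprime hg hgs hg1 fun t h1 h2 => ?_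
    have h : g * y * star t + t * y * g = g * (a + b) * star t + t * (a + b) * g := by
      apply hψ.bijective.injective
      rw [hadd t h1 h2]
      simp only [hψ.map_corner hg hgs h1, hy, jordanStar, mul_add, add_mul, mul_sub, sub_mul]
      abel
    rw [← sub_eq_zero] at h
    rw [← h]
    simp only [mul_sub, sub_mul]
    abel
  have hy' : y = a + b := by
    refine sub_eq_zero.1 (eq_zero_of_peirce he (corner e he hes he1 h11)
      (corner (1 - e) hf hfs (by simpa using he0) h22) ?_)
    have h : e * (e * y - y * e) - (e * y - y * e) * e =
        e * (e * (a + b) - (a + b) * e) - (e * (a + b) - (a + b) * e) * e := by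
      apply hψ.bijective.injective
      rw [hoff]
      simp only [hψ.lie e _ hes, hy]
      simp only [mul_add, add_mul, mul_sub, sub_mul]
      abel
    rw [← sub_eq_zero] at h
    rw [← h]
    simp only [mul_sub, sub_mul]
    abel
  rw [← hy', hy]

theorem map_offDiag_add_diag (hψ : IsJordanLieMap ψ)
    (hprime : ∀ X Y : R, (∀ Z, X * Z * Y = 0) → X = 0 ∨ Y = 0)
    {e : R} (he : e * e = e) (hes : star e = e) (he0 : e ≠ 0) (he1 : e ≠ 1) {b g : R}
    (hb : e * b + b * e = b) (hg : e * g = g * e) : ψ (b + g) = ψ b + ψ g := by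
  have heb : e * b * e = 0 := by
    have h := congrArg (e * ·) hb
    simpa [mul_add, ← mul_assoc, he] using h
  have hfb : (1 - e) * b * (1 - e) = 0 := by
    simp only [sub_mul, mul_sub, one_mul, mul_one, heb]
    nth_rewrite 1 [← hb]
    abel
  have corner : ∀ p t : R, star p = p → p * b * p = 0 → t * p = t →
      p * b * star t + t * b * p = 0 := by
    intro p t hp hpb hpt
    have h : star t = p * star t := by simpa [hp] using congrArg star hpt.symm
    rw [h, ← mul_assoc, hpb, zero_mul, ← hpt, mul_assoc t, mul_assoc t, hpb, mul_zero, add_zero]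
  refine hψ.map_add_of_peirce hprime he hes he0 he1 ?_ ?_ ?_
  · have h : e * (b + g) - (b + g) * e = e * b - b * e := by
      rw [mul_add, add_mul, hg]; abel
    rw [h, hg, sub_self]
    simp [hψ.map_zero]
  · intro t _ h2
    have h := corner e t hes heb h2
    have h' : e * (b + g) * star t + t * (b + g) * e = e * g * star t + t * g * e := by
      rw [← zero_add (e * g * star t + _), ← h]
      simp only [mul_add, add_mul]; abel
    rw [h', h, hψ.map_zero, zero_add]
  · intro t _ h2
    have h := corner (1 - e) t (by simp [hes]) hfb h2
    have h' : (1 - e) * (b + g) * star t + t * (b + g) * (1 - e)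
        = (1 - e) * g * star t + t * g * (1 - e) := by
      rw [← zero_add ((1 - e) * g * star t + _), ← h]
      simp only [mul_add, add_mul]; abel
    rw [h', h, hψ.map_zero, zero_add]

theorem map_offDiag_add (hψ : IsJordanLieMap ψ)
    (hprime : ∀ X Y : R, (∀ Z, X * Z * Y = 0) → X = 0 ∨ Y = 0)
    {e : R} (he : e * e = e) (hes : star e = e) (he0 : e ≠ 0) (he1 : e ≠ 1) {b b' : R}
    (hbs : star b = b) (hb : e * b + b * e = b) (hb' : e * b' + b' * e = b') :
    ψ (b + b') = ψ b + ψ b' := by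
  have hdiag := fun {b g : R} => hψ.map_offDiag_add_diag (b := b) (g := g) hprime he hes he0 he1
  have comm : ∀ x y : R, e * x + x * e = x → e * y + y * e = y → e * (x * y) = x * y * e := by
    intro x y hx hy
    have h1 : e * x = x - x * e := eq_sub_of_add_eq hx
    have h2 : e * y = y - y * e := eq_sub_of_add_eq hy
    rw [← mul_assoc, h1, sub_mul, mul_assoc x e y, h2, mul_sub, mul_assoc]
    abel
  have hg : e * (b * b' + b' * b) = (b * b' + b' * b) * e := by
    rw [mul_add, add_mul, comm b b' hb hb', comm b' b hb' hb]
  have hef : e * (1 - e) = 0 := by rw [mul_sub, mul_one, he, sub_self]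
  have hfe : (1 - e) * e = 0 := by rw [sub_mul, one_mul, he, sub_self]
  have hbf : b * (1 - e) + (1 - e) * b = b := by
    calc _ = b + (b - (e * b + b * e)) := by simp only [mul_sub, sub_mul, mul_one, one_mul]; abel
      _ = b := by rw [hb, sub_self, add_zero]
  have key : (b + e) * (b' + (1 - e)) + (b' + (1 - e)) * (b + e) =
      (b + b') + (b * b' + b' * b) := by
    calc _ = (b * (1 - e) + (1 - e) * b) + (e * b' + b' * e) + (b * b' + b' * b)
          + (e * (1 - e) + (1 - e) * e) := by
            generalize 1 - e = f
            simp only [mul_add, add_mul]; abel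
      _ = _ := by rw [hbf, hb', hef, hfe]; abel
  have h := hψ.jordan_selfAdjoint (h := b + e) (by simp [hbs, hes]) (b' + (1 - e))
  rw [key, hdiag (by rw [mul_add, add_mul, ← add_add_add_comm, hb, hb']) hg, hdiag hb rfl,
    hdiag hb' (by rw [hef, hfe])] at h
  have e1 := hψ.jordan_selfAdjoint hbs b'
  have e2 := hψ.jordan_selfAdjoint hbs (1 - e)
  have e3 := hψ.jordan_selfAdjoint hes b'
  have e4 := hψ.jordan_selfAdjoint hes (1 - e)
  rw [hbf] at e2
  rw [hb'] at e3
  rw [hef, hfe, add_zero, hψ.map_zero] at e4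
  have h' : (ψ b + ψ e) * (ψ b' + ψ (1 - e)) + (ψ b' + ψ (1 - e)) * (ψ b + ψ e) =
      (ψ b + ψ b') + ψ (b * b' + b' * b) + 0 := by
    calc _ = (ψ b * ψ (1 - e) + ψ (1 - e) * ψ b) + (ψ e * ψ b' + ψ b' * ψ e)
          + (ψ b * ψ b' + ψ b' * ψ b) + (ψ e * ψ (1 - e) + ψ (1 - e) * ψ e) := by
            simp only [mul_add, add_mul]; abel
      _ = _ := by rw [← e1, ← e2, ← e3, ← e4]
  rw [h', add_zero] at h
  exact add_right_cancel h

/-- A nontrivial projection in a prime *-ring forces a bijection compatible with the Jordan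
*-product, and with commutators by self-adjoint elements, to be additive on self-adjoint
elements. -/
theorem map_add_selfAdjoint (hψ : IsJordanLieMap ψ)
    (hprime : ∀ X Y : R, (∀ Z, X * Z * Y = 0) → X = 0 ∨ Y = 0)
    {e : R} (he : e * e = e) (hes : star e = e) (he0 : e ≠ 0) (he1 : e ≠ 1) {a b : R}
    (ha : star a = a) : ψ (a + b) = ψ a + ψ b := by
  have hadd := fun {b b' : R} => hψ.map_offDiag_add (b := b) (b' := b') hprime he hes he0 he1
  have off : ∀ y : R, e * (e * (e * y - y * e) - (e * y - y * e) * e)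
      + (e * (e * y - y * e) - (e * y - y * e) * e) * e
      = e * (e * y - y * e) - (e * y - y * e) * e := by
    intro y
    simp only [mul_sub, sub_mul, ← mul_assoc, he]
    simp only [mul_assoc, he]
    abel
  have corner : ∀ t y : R, e * t = 0 → t * e = t →
      e * (e * y * star t + t * y * e) + (e * y * star t + t * y * e) * e =
      e * y * star t + t * y * e := by
    intro t y h1 h2
    have h3 : star t * e = 0 := by rw [← hes, ← star_mul, h1, star_zero]
    simp only [mul_add, add_mul, ← mul_assoc, he, h1]
    simp only [mul_assoc, he, h3]
    simp
  have corner' : ∀ t y : R, (1 - e) * t = 0 → t * (1 - e) = t →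
      e * ((1 - e) * y * star t + t * y * (1 - e))
        + ((1 - e) * y * star t + t * y * (1 - e)) * e =
      (1 - e) * y * star t + t * y * (1 - e) := by
    intro t y h1 h2
    have h3 : e * t = t := by
      rw [sub_mul, one_mul, sub_eq_zero] at h1; exact h1.symm
    have h4 : star t * e = star t := by rw [← hes, ← star_mul, h3]
    have hef : e * (1 - e) = 0 := by rw [mul_sub, mul_one, he, sub_self]
    have hfe : (1 - e) * e = 0 := by rw [sub_mul, one_mul, he, sub_self]
    generalize 1 - e = f at *
    simp only [mul_add, add_mul, ← mul_assoc, hef, h3]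
    simp only [mul_assoc, hfe, h4]
    simp [add_comm]
  refine hψ.map_add_of_peirce hprime he hes he0 he1 ?_ ?_ ?_
  · rw [← hadd _ (off a) (off b)]
    · congr 1
      simp only [mul_add, add_mul, mul_sub, sub_mul]; abel
    · simp only [star_sub, star_mul, hes, ha, mul_sub, sub_mul, mul_assoc]; abel
  · intro t h1 h2
    rw [← hadd _ (corner t a h1 h2) (corner t b h1 h2)]
    · congr 1
      simp only [mul_add, add_mul]; abel
    · simp [hes, ha, mul_assoc, add_comm]
  · intro t h1 h2
    rw [← hadd _ (corner' t a h1 h2) (corner' t b h1 h2)]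
    · congr 1
      generalize 1 - e = f
      simp only [mul_add, add_mul]; abel
    · have hfs : star (1 - e) = 1 - e := by simp [hes]
      generalize 1 - e = f at *
      simp [hfs, ha, mul_assoc, add_comm]

end IsJordanLieMap

end Additive

section Scaled

theorem commute_of_commute_skew {B : Type*} [Ring B] [StarRing B] [Algebra ℂ B] [StarModule ℂ B]
    {a : B} (h : ∀ z, star z = -z → a * z = z * a) (z : B) : a * z = z * a := by
  have h1 := h (z - star z) (by simp)
  have h2 := h (Complex.I • (z + star z)) (by simp [add_comm])
  rw [mul_smul_comm, smul_mul_assoc] at h2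
  have h3 := smul_right_injective B Complex.I_ne_zero h2
  have h4 : (2 : ℂ) • (a * z) = (2 : ℂ) • (z * a) := by
    calc (2 : ℂ) • (a * z) = a * (z - star z) + a * (z + star z) := by
          rw [two_smul]; simp only [mul_sub, mul_add]; abel
      _ = (z - star z) * a + (z + star z) * a := by rw [h1, h3]
      _ = (2 : ℂ) • (z * a) := by
          rw [two_smul]; simp only [sub_mul, add_mul]; abel
  exact smul_right_injective B two_ne_zero h4

variable {A B : Type*} [Ring A] [StarRing A] [Algebra ℂ A]
  [Ring B] [StarRing B] [Algebra ℂ B]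

/-- The identities which a unital multiplicative *-Lie-Jordan `(m + 2)`-map satisfies, with
`c = 2 ^ m`. -/
structure IsScaledLieJordanMap (c : ℂ) (φ : A → B) : Prop where
  bijective : Function.Bijective φ
  map_one : φ 1 = 1
  jordan : ∀ x y, φ (c • jordanStar x y) = c • jordanStar (φ x) (φ y)
  sub_star : ∀ x, φ (c • (x - star x)) = c • (φ x - star (φ x))
  skew : ∀ x y, star x = -x → φ (c • (x * y + y * x)) = c • (φ x * φ y + φ y * φ x)

theorem isScaledLieJordanMap_of_preserves [StarModule ℂ A] [StarModule ℂ B]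
    {m : ℕ} {φ : A → B} (hbij : Function.Bijective φ)
    (h1 : φ 1 = 1)
    (hp : ∀ (x : A) (l : List A), l.length = m + 1 → φ (pStar x l) = pStar (φ x) (l.map φ))
    (hq : ∀ (x : A) (l : List A), l.length = m + 1 → φ (qStar x l) = qStar (φ x) (l.map φ)) :
    IsScaledLieJordanMap ((2 : ℂ) ^ m) φ := by
  have jordan : ∀ x y, φ ((2 : ℂ) ^ m • jordanStar x y) = (2 : ℂ) ^ m • jordanStar (φ x) (φ y) := by
    intro x y
    cases m with
    | zero => simpa [qStar] using hq x [y] rfl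
    | succ k =>
      have h := hq 1 (List.replicate k 1 ++ [x, y]) (by simp)
      rwa [qStar_one_replicate_one_concat, List.map_append, List.map_replicate, h1, List.map_cons,
        List.map_cons, List.map_nil, qStar_one_replicate_one_concat] at h
  have h0 : φ 0 = 0 := by
    have h := hp 1 (List.replicate (m + 1) 1) (by simp)
    rwa [List.map_replicate, h1, pStar_replicate_succ_one, pStar_replicate_succ_one, star_one,
      star_one, sub_self, sub_self, smul_zero, smul_zero] at h
  refine ⟨hbij, h1, jordan, fun x => ?_, fun x y hx => ?_⟩
  · have h := hp x (List.replicate (m + 1) 1) (by simp)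
    rwa [List.map_replicate, h1, pStar_replicate_succ_one, pStar_replicate_succ_one] at h
  · have hx' : star (φ x) = -φ x := by
      have h := jordan x 1
      simp only [jordanStar, h1, mul_one, one_mul, hx, add_neg_cancel, smul_zero, h0] at h
      exact (neg_eq_of_add_eq_zero_right ((smul_eq_zero.1 h.symm).resolve_left (by simp))).symm
    have h := hp x (List.replicate m 1 ++ [y]) (by simp)
    rwa [List.map_append, List.map_replicate, h1, List.map_cons, List.map_nil,
      pStar_replicate_one_concat hx, pStar_replicate_one_concat hx'] at h

namespace IsScaledLieJordanMap

variable {c : ℂ} {φ : A → B}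

theorem map_zero (hφ : IsScaledLieJordanMap c φ) : φ 0 = 0 := by
  simpa [hφ.map_one] using hφ.sub_star 1

theorem map_mul_two_smul (hφ : IsScaledLieJordanMap c φ) (x : A) :
    φ ((c * 2) • x) = (c * 2) • φ x := by
  have h := hφ.jordan 1 x
  simpa [jordanStar, hφ.map_one, mul_smul, two_smul] using h

theorem star_of_selfAdjoint (hφ : IsScaledLieJordanMap c φ) (hc : c ≠ 0) {x : A}
    (hx : star x = x) : star (φ x) = φ x := by
  have h := hφ.sub_star x
  rw [hx, sub_self, smul_zero, hφ.map_zero] at h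
  exact (sub_eq_zero.1 ((smul_eq_zero.1 h.symm).resolve_left hc)).symm

theorem star_eq_neg_iff (hφ : IsScaledLieJordanMap c φ) (hc : c ≠ 0) (x : A) :
    star (φ x) = -φ x ↔ star x = -x := by
  have h := hφ.jordan x 1
  simp only [jordanStar, hφ.map_one, mul_one, one_mul] at h
  rw [eq_neg_iff_add_eq_zero, eq_neg_iff_add_eq_zero, add_comm, add_comm _ x]
  constructor
  · intro h'
    rw [h', smul_zero, ← hφ.map_zero] at h
    exact (smul_eq_zero.1 (hφ.bijective.injective h)).resolve_left hc
  · intro h'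
    rw [h', smul_zero, hφ.map_zero] at h
    exact (smul_eq_zero.1 h.symm).resolve_left hc

theorem two_smul_map (hφ : IsScaledLieJordanMap 1 φ) (x : A) :
    (2 : ℂ) • φ x = φ (x + star x) + φ (x - star x) := by
  have h1 := hφ.jordan x 1
  have h2 := hφ.sub_star x
  simp only [one_smul, jordanStar, mul_one, one_mul, hφ.map_one] at h1 h2
  rw [h1, h2, two_smul]
  abel

variable [StarModule ℂ B]

theorem commute_map_smul_one (hφ : IsScaledLieJordanMap c φ) (hc : c ≠ 0) (r : ℂ) (z : B) :
    φ (r • 1) * z = z * φ (r • 1) := by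
  refine commute_of_commute_skew (fun z hz => ?_) _
  obtain ⟨y, rfl⟩ := hφ.bijective.surjective z
  have h := hφ.jordan y (r • 1)
  simp only [jordanStar, (hφ.star_eq_neg_iff hc y).1 hz, hz, mul_smul_comm, smul_mul_assoc,
    mul_one, one_mul, add_neg_cancel, smul_zero, hφ.map_zero, mul_neg] at h
  have h := (smul_eq_zero.1 h.symm).resolve_left hc
  rw [← sub_eq_add_neg, sub_eq_zero] at h
  exact h.symm

variable [StarModule ℂ A]

theorem map_real_smul (hφ : IsScaledLieJordanMap c φ) (hc : c ≠ 0) {r : ℂ} (hr : star r = r)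
    (x : A) : φ (r • x) = φ (r • 1) * φ x := by
  have hsa : star (r • (1 : A)) = r • 1 := by rw [star_smul, hr, star_one]
  have h := hφ.jordan (r • 1) x
  have h2 : c • jordanStar (r • (1 : A)) x = (c * 2) • r • x := by
    simp only [jordanStar, hsa, mul_smul_comm, smul_mul_assoc, mul_one, one_mul, mul_smul, two_smul]
  rw [h2, hφ.map_mul_two_smul, jordanStar, hφ.star_of_selfAdjoint hc hsa,
    ← hφ.commute_map_smul_one hc r, ← two_smul ℂ, ← mul_smul] at h
  exact smul_right_injective B (mul_ne_zero hc two_ne_zero) h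

/-- Unlike general complex scalars, the scalar `2` and its powers are preserved exactly; this uses
positivity of squares of self-adjoint elements in a C*-algebra. -/
theorem map_two_smul {B : Type*} [CStarAlgebra B] {φ : A → B} {m : ℕ}
    (hφ : IsScaledLieJordanMap ((2 : ℂ) ^ m) φ) (x : A) : φ ((2 : ℂ) • x) = (2 : ℂ) • φ x := by
  have hc : (2 : ℂ) ^ m ≠ 0 := by simp
  set r : ℂ := ((Real.sqrt 2 : ℝ) : ℂ) with hrdef
  have hr : star r = r := Complex.conj_ofReal _
  have hrr : r * r = 2 := by
    rw [hrdef, ← Complex.ofReal_mul, Real.mul_self_sqrt (by norm_num)]; simp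
  have hu : star (φ (r • 1)) = φ (r • 1) :=
    hφ.star_of_selfAdjoint hc (by rw [star_smul, hr, star_one])
  have h2 : ∀ y, φ ((2 : ℂ) • y) = φ (r • 1) ^ 2 * φ y := by
    intro y
    rw [← hrr, mul_smul, hφ.map_real_smul hc hr, hφ.map_real_smul hc hr y, sq, mul_assoc]
  have hpow : ∀ k : ℕ, φ ((2 : ℂ) ^ k • 1) = (φ (r • 1) ^ 2) ^ k := by
    intro k
    induction k with
    | zero => simp [hφ.map_one]
    | succ k ih => rw [pow_succ', mul_smul, h2, ih, pow_succ' (φ (r • 1) ^ 2)]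
  have hM : (φ (r • 1) ^ 2) ^ (m + 1) = 2 ^ (m + 1) := by
    rw [← hpow, pow_succ, hφ.map_mul_two_smul, hφ.map_one, ← pow_succ, Algebra.smul_def,
      _root_.map_pow, map_ofNat]
    simp
  rw [h2, sq_eq_two_of_pow_eq hu m.succ_ne_zero hM, two_smul, two_mul]

theorem map_two_pow_smul {B : Type*} [CStarAlgebra B] {φ : A → B} {m : ℕ}
    (hφ : IsScaledLieJordanMap ((2 : ℂ) ^ m) φ) (k : ℕ) (x : A) :
    φ ((2 : ℂ) ^ k • x) = (2 : ℂ) ^ k • φ x := by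
  induction k generalizing x with
  | zero => simp
  | succ k ih => rw [pow_succ', mul_smul, hφ.map_two_smul, ih, mul_smul]

/-- The scaling factor `2 ^ m` can be removed from all identities. -/
theorem unscale {B : Type*} [CStarAlgebra B] {φ : A → B} {m : ℕ}
    (hφ : IsScaledLieJordanMap ((2 : ℂ) ^ m) φ) : IsScaledLieJordanMap 1 φ := by
  have cancel : ∀ {a b : B}, (2 : ℂ) ^ m • a = (2 : ℂ) ^ m • b → a = b :=
    fun h => smul_right_injective B (pow_ne_zero m two_ne_zero) h
  refine ⟨hφ.bijective, hφ.map_one, fun x y => ?_, fun x => ?_, fun x y hx => ?_⟩ <;>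
    rw [one_smul, one_smul] <;> refine cancel ?_ <;> rw [← hφ.map_two_pow_smul]
  · exact hφ.jordan x y
  · exact hφ.sub_star x
  · exact hφ.skew x y hx

theorem map_neg [Nontrivial A] (hφ : IsScaledLieJordanMap 1 φ)
    (hprime : ∀ X Y : B, (∀ Z, X * Z * Y = 0) → X = 0 ∨ Y = 0) (x : A) : φ (-x) = -φ x := by
  have hr : star (-1 : ℂ) = -1 := by simp
  have hmul := hφ.map_real_smul one_ne_zero hr
  have hcomm := hφ.commute_map_smul_one one_ne_zero (-1)
  have hsq : φ ((-1 : ℂ) • 1) * φ ((-1 : ℂ) • 1) = 1 := by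
    rw [← hmul, smul_smul]; simp [hφ.map_one]
  have h := hprime (φ ((-1 : ℂ) • 1) - 1) (φ ((-1 : ℂ) • 1) + 1) fun Z => by
    have h1 : φ ((-1 : ℂ) • 1) * Z * φ ((-1 : ℂ) • 1) = Z := by
      rw [hcomm, mul_assoc, hsq, mul_one]
    rw [mul_add, sub_mul, sub_mul, h1, one_mul, mul_one, hcomm]
    abel
  rw [← neg_one_smul ℂ x, hmul]
  rcases h with h | h
  · rw [sub_eq_zero, ← hφ.map_one] at h
    have h := hφ.bijective.injective h
    have h2 : (2 : ℂ) • (1 : A) = 0 := by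
      rw [two_smul]; nth_rewrite 1 [← h]; simp
    simp at h2
  · rw [eq_neg_of_add_eq_zero_left h, neg_one_mul]

theorem map_I_smul (hφ : IsScaledLieJordanMap 1 φ) (x : A) :
    φ (Complex.I • x) = φ (Complex.I • 1) * φ x := by
  have h := hφ.skew (Complex.I • 1) x (by simp)
  have h2 := hφ.map_mul_two_smul (Complex.I • x)
  simp only [one_mul, one_smul, two_smul, smul_mul_assoc, mul_one, mul_smul_comm] at h h2
  rw [h, ← hφ.commute_map_smul_one one_ne_zero, ← two_smul ℂ, ← two_smul ℂ] at h2
  exact (smul_right_injective B two_ne_zero h2).symm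

theorem map_I_smul_I_smul [Nontrivial A] (hφ : IsScaledLieJordanMap 1 φ)
    (hprime : ∀ X Y : B, (∀ Z, X * Z * Y = 0) → X = 0 ∨ Y = 0) :
    φ (Complex.I • 1) * φ (Complex.I • 1) = -1 := by
  rw [← hφ.map_I_smul, smul_smul, Complex.I_mul_I, neg_one_smul, hφ.map_neg hprime, hφ.map_one]

theorem map_star [Nontrivial A] (hφ : IsScaledLieJordanMap 1 φ)
    (hprime : ∀ X Y : B, (∀ Z, X * Z * Y = 0) → X = 0 ∨ Y = 0) (x : A) :
    φ (star x) = star (φ x) := by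
  have h1 := hφ.jordan x 1
  have h2 := hφ.sub_star x
  simp only [one_smul, jordanStar, mul_one, one_mul, hφ.map_one] at h1 h2
  have h := hφ.two_smul_map (star x)
  rw [star_star, add_comm, ← neg_sub x, hφ.map_neg hprime, add_comm (star x), h1, h2] at h
  refine smul_right_injective B (two_ne_zero (α := ℂ)) ?_
  simp only [h, two_smul]
  abel

theorem map_lie [Nontrivial A] (hφ : IsScaledLieJordanMap 1 φ)
    (hprime : ∀ X Y : B, (∀ Z, X * Z * Y = 0) → X = 0 ∨ Y = 0) {h : A} (hh : star h = h) (y : A) :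
    φ (h * y - y * h) = φ h * φ y - φ y * φ h := by
  have hJ := hφ.jordan (Complex.I • h) y
  have e1 : jordanStar (Complex.I • h) y = Complex.I • (h * y - y * h) := by
    simp [jordanStar, hh, sub_eq_add_neg]
  have e2 : star (φ (Complex.I • 1) * φ h) = -(φ (Complex.I • 1) * φ h) := by
    rw [← hφ.map_I_smul, hφ.star_eq_neg_iff one_ne_zero]
    simp [hh]
  rw [one_smul, one_smul, e1, hφ.map_I_smul, hφ.map_I_smul h, jordanStar, e2, mul_neg,
    ← mul_assoc (φ y), ← hφ.commute_map_smul_one one_ne_zero _ (φ y), mul_assoc, mul_assoc, ← sub_eq_add_neg,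
    ← mul_sub] at hJ
  have hJ := congrArg (φ (Complex.I • 1) * ·) hJ
  simpa only [← mul_assoc, hφ.map_I_smul_I_smul hprime, neg_one_mul, neg_inj] using hJ

theorem isJordanLieMap_symm [Nontrivial A] (hφ : IsScaledLieJordanMap 1 φ)
    (hprime : ∀ X Y : B, (∀ Z, X * Z * Y = 0) → X = 0 ∨ Y = 0) :
    IsJordanLieMap (Equiv.ofBijective φ hφ.bijective).symm := by
  set e := Equiv.ofBijective φ hφ.bijective
  have he : ∀ x, e x = φ x := fun _ => rfl
  have hsa : ∀ h, star h = h → star (e.symm h) = e.symm h := by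
    intro h hh
    apply e.injective
    rw [he, hφ.map_star hprime, ← he, e.apply_symm_apply, hh]
  refine ⟨e.symm.bijective, ?_, fun x y => ?_, fun h y hh => ?_, hsa⟩ <;>
    rw [e.symm_apply_eq, he]
  · exact hφ.map_zero.symm
  · have h := hφ.jordan (e.symm x) (e.symm y)
    rw [one_smul, one_smul] at h
    rw [h, ← he, ← he, e.apply_symm_apply, e.apply_symm_apply]
  · rw [hφ.map_lie hprime (hsa h hh), ← he, ← he, e.apply_symm_apply, e.apply_symm_apply]

theorem map_add_selfAdjoint [Nontrivial A] (hφ : IsScaledLieJordanMap 1 φ)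
    (hprime : ∀ X Y : B, (∀ Z, X * Z * Y = 0) → X = 0 ∨ Y = 0)
    {P : A} (hP : P * P = P) (hPs : star P = P) (hP0 : P ≠ 0) (hP1 : P ≠ 1) {a : A} (b : A)
    (ha : star a = a) : φ (a + b) = φ a + φ b := by
  have hQ : φ P * φ P = φ P := by
    have h := hφ.jordan P P
    have h2 := hφ.map_mul_two_smul P
    simp only [jordanStar, hPs, hφ.star_of_selfAdjoint one_ne_zero hPs, hP, one_smul,
      one_mul] at h h2
    rw [← two_smul ℂ, h2, ← two_smul ℂ] at h
    exact (smul_right_injective B two_ne_zero h).symm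
  have h := (hφ.isJordanLieMap_symm hprime).map_add_selfAdjoint (b := φ b) hprime hQ
    (hφ.star_of_selfAdjoint one_ne_zero hPs)
    (fun h => hP0 (hφ.bijective.injective (h.trans hφ.map_zero.symm)))
    (fun h => hP1 (hφ.bijective.injective (h.trans hφ.map_one.symm)))
    (hφ.star_of_selfAdjoint one_ne_zero ha)
  rw [Equiv.symm_apply_eq] at h
  simpa using h.symm

theorem map_add [Nontrivial A] (hφ : IsScaledLieJordanMap 1 φ)
    (hprime : ∀ X Y : B, (∀ Z, X * Z * Y = 0) → X = 0 ∨ Y = 0)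
    {P : A} (hP : P * P = P) (hPs : star P = P) (hP0 : P ≠ 0) (hP1 : P ≠ 1) (x y : A) :
    φ (x + y) = φ x + φ y := by
  have hadd := fun {a : A} b => hφ.map_add_selfAdjoint (a := a) hprime hP hPs hP0 hP1 b
  have hI : ∀ z : A, z = Complex.I • (-Complex.I) • z := by
    intro z; rw [smul_smul]; simp
  have hskew : φ ((x - star x) + (y - star y)) = φ (x - star x) + φ (y - star y) := by
    rw [hI (x - star x), hI (y - star y), ← smul_add, hφ.map_I_smul, hadd, mul_add,
      ← hφ.map_I_smul, ← hφ.map_I_smul]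
    rw [star_smul]
    simp only [star_sub, star_star, star_neg, Complex.star_def, Complex.conj_I, smul_sub, neg_smul]
    simp only [neg_neg]
    abel
  refine smul_right_injective B (two_ne_zero (α := ℂ)) ?_
  simp only [smul_add, hφ.two_smul_map, star_add]
  rw [add_add_add_comm, add_sub_add_comm, hskew, hadd _ (by simp [add_comm])]
  abel

theorem map_mul [Nontrivial A] (hφ : IsScaledLieJordanMap 1 φ)
    (hprime : ∀ X Y : B, (∀ Z, X * Z * Y = 0) → X = 0 ∨ Y = 0)
    {P : A} (hP : P * P = P) (hPs : star P = P) (hP0 : P ≠ 0) (hP1 : P ≠ 1) (x y : A) :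
    φ (x * y) = φ x * φ y := by
  have hadd := hφ.map_add hprime hP hPs hP0 hP1
  have htwo : ∀ {a b : B}, a + a = b + b → a = b := by
    intro a b h
    rw [← two_smul ℂ, ← two_smul ℂ] at h
    exact smul_right_injective B two_ne_zero h
  have hsa : ∀ h z : A, star h = h → φ (h * z) = φ h * φ z := by
    intro h z hh
    have h1 := hφ.jordan h z
    simp only [one_smul, jordanStar, hh, hφ.star_of_selfAdjoint one_ne_zero hh] at h1
    refine htwo ?_
    calc _ = φ ((h * z + z * h) + (h * z - z * h)) := by rw [← hadd]; congr 1; abel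
      _ = _ := by rw [hadd, h1, hφ.map_lie hprime hh]; abel
  have hI : x - star x = Complex.I • (-Complex.I) • (x - star x) := by
    rw [smul_smul]; simp
  have hskew : φ ((x - star x) * y) = φ (x - star x) * φ y := by
    rw [hI, smul_mul_assoc, hφ.map_I_smul, hφ.map_I_smul ((-Complex.I) • (x - star x)), hsa,
      mul_assoc]
    rw [star_smul]
    simp only [star_sub, star_star, star_neg, Complex.star_def, Complex.conj_I, smul_sub, neg_smul]
    simp only [neg_neg]
    abel
  refine htwo ?_
  calc _ = φ ((x + star x) * y + (x - star x) * y) := by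
        rw [← hadd]; congr 1; simp only [add_mul, sub_mul]; abel
    _ = (2 : ℂ) • φ x * φ y := by
        rw [hadd, hskew, hsa _ _ (by simp [add_comm]), ← add_mul, ← hφ.two_smul_map]
    _ = _ := by rw [two_smul, add_mul]

end IsScaledLieJordanMap

end Scaled

/-- Corollary for prime codomain. -/
theorem starLieJordanMap_iff_starRingIso_prime {A B : Type*} [NormedRing A] [StarRing A] [CStarRing A] [NormedAlgebra ℂ A] [CompleteSpace A] [StarModule ℂ A] [NormedRing B] [StarRing B] [CStarRing B] [NormedAlgebra ℂ B] [CompleteSpace B] [StarModule ℂ B]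
    (n : ℕ) (hn : 2 ≤ n) (φ : A → B) (hbij : Function.Bijective φ) (hφ1 : φ 1 = 1)
    (P : A) (hPidem : P * P = P) (hPsa : star P = P) (hP0 : P ≠ 0) (hP1 : P ≠ 1)
    (hprime : ∀ X Y : B, (∀ Z : B, X * Z * Y = 0) → X = 0 ∨ Y = 0) :
    ((∀ (x : A) (l : List A), l.length = n - 1 → φ (pStar x l) = pStar (φ x) (l.map φ)) ∧
     (∀ (x : A) (l : List A), l.length = n - 1 → φ (qStar x l) = qStar (φ x) (l.map φ)))
    ↔ ((∀ x y : A, φ (x + y) = φ x + φ y) ∧ (∀ x y : A, φ (x * y) = φ x * φ y) ∧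
       (∀ x : A, φ (star x) = star (φ x))) := by
  constructor
  · rintro ⟨hp, hq⟩
    let := { (inferInstance : NormedRing B), (inferInstance : StarRing B),
      (inferInstance : CStarRing B), (inferInstance : NormedAlgebra ℂ B),
      (inferInstance : CompleteSpace B), (inferInstance : StarModule ℂ B) with : CStarAlgebra B }
    have : Nontrivial A := nontrivial_of_ne P 0 hP0
    obtain ⟨m, rfl⟩ := Nat.exists_eq_add_of_le' hn
    have hφ := (isScaledLieJordanMap_of_preserves (m := m) hbij hφ1 hp hq).unscale
    exact ⟨hφ.map_add hprime hPidem hPsa hP0 hP1, hφ.map_mul hprime hPidem hPsa hP0 hP1,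
      hφ.map_star hprime⟩
  · rintro ⟨hadd, hmul, hstar⟩
    have hsub : ∀ x y, φ (x - y) = φ x - φ y := fun x y => by
      rw [eq_sub_iff_add_eq, ← hadd, sub_add_cancel]
    exact ⟨fun x l _ => map_foldl φ lieStar lieStar
        (fun x y => by simp only [lieStar, hsub, hmul, hstar]) x l,
      fun x l _ => map_foldl φ jordanStar jordanStar
        (fun x y => by simp only [jordanStar, hadd, hmul, hstar]) x l⟩
end

section
/- Let R be a *-ring and φ: R → R' a bijective additive map between unital *-rings such that φ(I) = I, φ(2^{n-2}(AB - BA*)) = 2^{n-2}(φ(A)φ(B) - φ(B)φ(A)*) and φ(2^{n-2}(AB + BA*)) = 2^{n-2}(φ(A)φ(B) + φ(B)φ(A)*) for all A, B, where the rings are torsion-free as ℤ-modules (e.g., C*-algebras so division by 2^{n-1} is valid). Then φ(AB) = φ(A)φ(B) for all A, B. -/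
/-- An additive bijective unital map between torsion-free unital *-rings that preserves
2^{n-2}([·,·]_*) and 2^{n-2}({·,·}_*) is multiplicative. -/
theorem additive_starLieJordan_is_mul {R S : Type*}
    [Ring R] [StarRing R] [Ring S] [StarRing S]
    [NoZeroSMulDivisors ℤ R] [NoZeroSMulDivisors ℤ S]
    (n : ℕ) (hn : 2 ≤ n) (φ : R → S) (hbij : Function.Bijective φ)
    (hadd : ∀ x y : R, φ (x + y) = φ x + φ y) (hφ1 : φ 1 = 1)
    (hlie : ∀ a b : R, φ (2 ^ (n - 2) * (a * b - b * star a))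
      = 2 ^ (n - 2) * (φ a * φ b - φ b * star (φ a)))
    (hjor : ∀ a b : R, φ (2 ^ (n - 2) * (a * b + b * star a))
      = 2 ^ (n - 2) * (φ a * φ b + φ b * star (φ a))) :
    ∀ a b : R, φ (a * b) = φ a * φ b := by
  intro a b
  set k := n - 2
  have hz : ∀ (m : ℤ) (x : R), φ (m • x) = m • φ x :=
    fun m x => map_zsmul (AddMonoidHom.mk' φ hadd) m x
  have hsum : φ ((2 ^ k * 2 : ℤ) • (a * b)) = (2 ^ k * 2 : ℤ) • (φ a * φ b) := by
    have hR : (2 ^ k * 2 : ℤ) • (a * b)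
        = 2 ^ k * (a * b - b * star a) + 2 ^ k * (a * b + b * star a) := by
      rw [zsmul_eq_mul]
      push_cast
      rw [← mul_add, mul_assoc, two_mul]
      congr 1
      abel
    rw [hR, hadd, hlie, hjor, zsmul_eq_mul]
    push_cast
    rw [← mul_add, mul_assoc, two_mul]
    congr 1
    abel
  rw [hz, ← sub_eq_zero, ← smul_sub] at hsum
  have hk : (2 ^ k * 2 : ℤ) ≠ 0 := by positivity
  exact sub_eq_zero.mp
    ((NoZeroSMulDivisors.eq_zero_or_eq_zero_of_smul_eq_zero hsum).resolve_left hk)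
end
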